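/- arXiv:2409.05844 — 13 statements merged into one kernel-verified Lean document; each statement's English description precedes it below -/
import Mathlib

section
/- Let P be a predicate on the positive integers that holds for infinitely many positive integers, and fix a positive integer n. Define g_n(x) = n + C_{¬P}(x) = n + x − C_P(x) for positive integers x. Then f_P(n) is the smallest fixed point of g_n: g_n(f_P(n)) = f_P(n), and every positive integer m with g_n(m) = m satisfies m ≥ f_P(n). -/
/-- `nthSat P n` is the `n`-th positive integer (indexed from `n = 1`) satisfying `P`. -/
noncomputable def nthSat (P : ℕ → Prop) (n : ℕ) : ℕ :=
  Nat.nth (fun m => 0 < m ∧ P m) (n - 1)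

/-- `countSat P x` is the number of positive integers `m ≤ x` satisfying `P`. -/
noncomputable def countSat (P : ℕ → Prop) (x : ℕ) : ℕ :=
  {m : ℕ | 0 < m ∧ m ≤ x ∧ P m}.ncard

open Classical in
theorem countSat_eq_count (P : ℕ → Prop) (x : ℕ) :
    countSat P x = Nat.count (fun m => 0 < m ∧ P m) (x + 1) := by
  rw [Nat.count_eq_card_filter_range, ← Set.ncard_coe_finset, countSat]
  congr 1
  ext m
  simp only [Set.mem_setOf_eq, Finset.coe_filter, Finset.mem_range, Nat.lt_succ_iff]
  tauto

theorem stmt_0 (P : ℕ → Prop) (hP : {m : ℕ | 0 < m ∧ P m}.Infinite)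
    (n : ℕ) (hn : 0 < n)
    (g : ℕ → ℕ) (hg : ∀ x : ℕ, g x = n + x - countSat P x) :
    g (nthSat P n) = nthSat P n ∧
      ∀ m : ℕ, 0 < m → g m = m → nthSat P n ≤ m := by
  classical
  refine ⟨?_, fun m hm h => ?_⟩
  · have h : countSat P (nthSat P n) = n := by
      rw [countSat_eq_count, nthSat, Nat.count_nth_succ_of_infinite hP]
      omega
    rw [hg, h]
    omega
  · rw [hg, countSat_eq_count] at h
    have h2 : nthSat P n < m + 1 := by
      apply Nat.nth_lt_of_lt_count
      omega
    omega
end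

section
/- Fix an integer k > 1. For every positive integer n, the n-th positive integer that is not a perfect k-th power equals n + ⌊n^{1/k}⌋ + 1 if n + ⌊n^{1/k}⌋ ≥ (⌊n^{1/k}⌋ + 1)^k, and equals n + ⌊n^{1/k}⌋ otherwise. -/
theorem aux_not (k : ℕ) (hk : 1 < k) (M r : ℕ) (h1 : r ^ k < M) (h2 : M < (r + 1) ^ k) :
    0 < M ∧ ¬∃ j : ℕ, 0 < j ∧ M = j ^ k := by
  refine ⟨by omega, ?_⟩
  rintro ⟨j, _, rfl⟩
  have a := lt_of_pow_lt_pow_left₀ k (Nat.zero_le _) h1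
  have b := lt_of_pow_lt_pow_left₀ k (Nat.zero_le _) h2
  omega

open Classical in
theorem aux_count (k : ℕ) (hk : 1 < k) (M : ℕ) : ∀ r : ℕ, r ^ k < M → M ≤ (r + 1) ^ k →
    Nat.count (fun m => 0 < m ∧ ¬∃ j : ℕ, 0 < j ∧ m = j ^ k) M + r + 1 = M := by
  induction M with
  | zero => intro r h; omega
  | succ M ih =>
    intro r h1 h2
    rw [Nat.count_succ]
    by_cases h : r ^ k < M
    · rw [if_pos (aux_not k hk M r h (by omega))]
      have := ih r h (by omega)
      omega
    · have hM : M = r ^ k := by omega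
      rcases Nat.eq_zero_or_pos r with h0 | h0
      · subst h0
        rw [zero_pow (by omega)] at hM
        subst hM
        simp
      · rw [if_neg (fun hh => hh.2 ⟨r, h0, hM⟩)]
        obtain ⟨s, rfl⟩ : ∃ s, r = s + 1 := ⟨r - 1, by omega⟩
        have hs : s ^ k < (s + 1) ^ k := Nat.pow_lt_pow_left (by omega) (by omega)
        have := ih s (by omega) (by omega)
        omega

theorem aux_nth (k : ℕ) (hk : 1 < k) (n M r : ℕ) (h1 : r ^ k < M) (h2 : M < (r + 1) ^ k)
    (h : n + r + 1 = M) :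
    Nat.nth (fun m => 0 < m ∧ ¬∃ j : ℕ, 0 < j ∧ m = j ^ k) n = M := by
  classical
  have hc := aux_count k hk M r h1 h2.le
  have := Nat.nth_count (p := fun m => 0 < m ∧ ¬∃ j : ℕ, 0 < j ∧ m = j ^ k)
    (aux_not k hk M r h1 h2)
  rwa [show Nat.count (fun m => 0 < m ∧ ¬∃ j : ℕ, 0 < j ∧ m = j ^ k) M = n by omega] at this

theorem stmt_3 (k : ℕ) (hk : 1 < k) (n : ℕ) (hn : 0 < n) :
    Nat.nth (fun m => 0 < m ∧ ¬∃ j : ℕ, 0 < j ∧ m = j ^ k) (n - 1) =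
      if n + ⌊(n : ℝ) ^ ((1 : ℝ) / k)⌋₊ ≥ (⌊(n : ℝ) ^ ((1 : ℝ) / k)⌋₊ + 1) ^ k
      then n + ⌊(n : ℝ) ^ ((1 : ℝ) / k)⌋₊ + 1
      else n + ⌊(n : ℝ) ^ ((1 : ℝ) / k)⌋₊ := by
  have hx0 : (0 : ℝ) ≤ (n : ℝ) ^ ((1 : ℝ) / k) := by positivity
  have hxk : ((n : ℝ) ^ ((1 : ℝ) / k)) ^ k = n := by
    rw [one_div]
    exact Real.rpow_inv_natCast_pow (by positivity) (by omega)
  have hx1 : (1 : ℝ) ≤ (n : ℝ) ^ ((1 : ℝ) / k) :=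
    Real.one_le_rpow (by exact_mod_cast hn) (by positivity)
  generalize (n : ℝ) ^ ((1 : ℝ) / k) = x at *
  have hr1 : 1 ≤ ⌊x⌋₊ := Nat.le_floor (by exact_mod_cast hx1)
  have hlo : ⌊x⌋₊ ^ k ≤ n := by
    have := pow_le_pow_left₀ (by positivity) (Nat.floor_le hx0) k
    rw [hxk] at this
    exact_mod_cast this
  have hhi : n < (⌊x⌋₊ + 1) ^ k := by
    have := pow_lt_pow_left₀ (Nat.lt_floor_add_one x) hx0 (n := k) (by omega)
    rw [hxk] at this
    exact_mod_cast this
  generalize ⌊x⌋₊ = r at *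
  split_ifs with h
  · apply aux_nth k hk _ _ (r + 1) (by omega) _ (by omega)
    obtain ⟨l, rfl⟩ : ∃ l, k = l + 1 := ⟨k - 1, by omega⟩
    have h1 : (r + 1) ^ l ≤ (r + 1 + 1) ^ l := Nat.pow_le_pow_left (by omega) l
    have h2 : r + 1 ≤ (r + 1) ^ l := Nat.le_self_pow (by omega) _
    have h3 : (r + 1 + 1) ^ (l + 1) ≥ (r + 1) ^ (l + 1) + (r + 1) ^ l := by
      rw [pow_succ, pow_succ]
      nlinarith
    omega
  · exact aux_nth k hk _ _ r (by omega) (by omega) (by omega)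
end

section
/- Fix an integer k ≥ 2. For every positive integer n, the n-th positive integer that is not a power of k (i.e., not of the form k^j for some integer j ≥ 0) equals n + 1 + ⌊log_k n⌋ + 1 if n + 1 + ⌊log_k n⌋ ≥ k^{⌊log_k n⌋ + 1}, and equals n + 1 + ⌊log_k n⌋ otherwise. -/
lemma not_pow_between (k : ℕ) (hk : 2 ≤ k) (L m : ℕ) (h1 : k ^ L < m) (h2 : m < k ^ (L + 1)) :
    0 < m ∧ ¬∃ j : ℕ, m = k ^ j := by
  refine ⟨by omega, ?_⟩
  rintro ⟨j, rfl⟩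
  have a := (Nat.pow_lt_pow_iff_right (by omega : 1 < k)).1 h1
  have b := (Nat.pow_lt_pow_iff_right (by omega : 1 < k)).1 h2
  omega

open Classical in
lemma count_aux (k : ℕ) (hk : 2 ≤ k) (m : ℕ) : ∀ L : ℕ, k ^ L ≤ m → m < k ^ (L + 1) →
    Nat.count (fun m => 0 < m ∧ ¬∃ j : ℕ, m = k ^ j) (m + 1) + L + 1 = m := by
  induction m with
  | zero =>
    intro L h
    have : 0 < k ^ L := by positivity
    omega
  | succ m ih =>
    intro L h1 h2
    rw [Nat.count_succ]
    rcases h1.eq_or_lt with h | h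
    · rw [if_neg (fun hp => hp.2 ⟨L, h.symm⟩)]
      cases L with
      | zero =>
        have : m = 0 := by simpa using h.symm
        subst this
        simp [Nat.count_succ]
      | succ L =>
        have h3 : k ^ L < k ^ (L + 1) := Nat.pow_lt_pow_right (by omega) (by omega)
        have := ih L (by omega) (by omega)
        omega
    · rw [if_pos (not_pow_between k hk L _ h h2)]
      have := ih L (by omega) (by omega)
      omega

theorem stmt_5 (k : ℕ) (hk : 2 ≤ k) (n : ℕ) (hn : 0 < n) :
    Nat.nth (fun m => 0 < m ∧ ¬∃ j : ℕ, m = k ^ j) (n - 1) =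
      if n + 1 + Nat.log k n ≥ k ^ (Nat.log k n + 1)
      then n + 1 + Nat.log k n + 1
      else n + 1 + Nat.log k n := by
  classical
  have hL1 : k ^ Nat.log k n ≤ n := Nat.pow_log_le_self k (by omega)
  have hL2 : n < k ^ (Nat.log k n + 1) := Nat.lt_pow_succ_log_self (by omega) n
  generalize Nat.log k n = L at *
  have key : ∀ M m : ℕ, k ^ M ≤ m → m + 1 < k ^ (M + 1) → m = n + M →
      Nat.nth (fun m => 0 < m ∧ ¬∃ j : ℕ, m = k ^ j) (n - 1) = m + 1 := by
    intro M m h1 h2 h3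
    have hc := count_aux k hk m M h1 (by omega)
    have hp := not_pow_between k hk M (m + 1) (by omega) h2
    have hn' := Nat.nth_count (p := fun m => 0 < m ∧ ¬∃ j : ℕ, m = k ^ j) hp
    rwa [show Nat.count (fun m => 0 < m ∧ ¬∃ j : ℕ, m = k ^ j) (m + 1) = n - 1 by omega] at hn'
  split_ifs with h
  · have h4 : L + 1 < k ^ (L + 1) := Nat.lt_pow_self (by omega)
    have h5 : k ^ (L + 1) * 2 ≤ k ^ (L + 1 + 1) := by
      rw [pow_succ k (L + 1)]
      exact Nat.mul_le_mul_left _ hk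
    exact key (L + 1) (n + 1 + L) h (by omega) (by omega)
  · have := key L (n + L) (by omega) (by omega) rfl
    omega
end

section
/- Let P be a predicate on the positive integers such that both P and ¬P hold for infinitely many positive integers, and suppose f_{¬P}(m+1) − f_{¬P}(m) ≥ m for all positive integers m. Let α be a real-valued increasing function on the positive integers with α(1) = 1 and f_{¬P}(m−1) ≤ α(m) ≤ f_{¬P}(m) for all m ≥ 2 and α(1) ≤ f_{¬P}(1), and define h(n) = max{m ∈ ℕ⁺ : α(m) ≤ n} (this maximum exists since α(m) ≥ f_{¬P}(m−1) → ∞). Then for every positive integer n: f_P(n) = n + h(n) + 1 if n + h(n) ≥ f_{¬P}(h(n) + 1); f_P(n) = n + h(n) − 1 if n + h(n) ≤ f_{¬P}(h(n)); and f_P(n) = n + h(n) otherwise. -/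
open Classical in
theorem count_add_aux (P : ℕ → Prop) (M : ℕ) :
    Nat.count (fun m => 0 < m ∧ P m) (M + 1) + Nat.count (fun m => 0 < m ∧ ¬ P m) (M + 1) = M := by
  induction M with
  | zero => simp [Nat.count_succ]
  | succ M ih =>
    rw [Nat.count_succ (fun m => 0 < m ∧ P m) (M + 1),
      Nat.count_succ (fun m => 0 < m ∧ ¬ P m) (M + 1)]
    by_cases hp : P (M + 1) <;> simp [hp] <;> omega

open Classical in
theorem key_aux (P : ℕ → Prop)
    (hP' : {m : ℕ | 0 < m ∧ ¬ P m}.Infinite) (n k : ℕ) (hn : 0 < n)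
    (h1 : 0 < k → nthSat (fun x => ¬ P x) k < n + k)
    (h2 : n + k < nthSat (fun x => ¬ P x) (k + 1)) : nthSat P n = n + k := by
  unfold nthSat at *
  simp only [Nat.add_sub_cancel] at h2
  have c1 : Nat.count (fun m => 0 < m ∧ ¬ P m) (n + k) ≤ k := by
    by_contra hc
    have := Nat.nth_lt_of_lt_count (not_le.1 hc)
    omega
  have c2 : k ≤ Nat.count (fun m => 0 < m ∧ ¬ P m) (n + k) := by
    by_contra hc
    have hk : 0 < k := by omega
    have h3 : Nat.count (fun m => 0 < m ∧ ¬ P m) (n + k) ≤ k - 1 := by omega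
    have h4 := (Nat.count_le_iff_le_nth hP').1 h3
    exact absurd (h1 hk) (not_lt.2 h4)
  have c : Nat.count (fun m => 0 < m ∧ ¬ P m) (n + k) = k := le_antisymm c1 c2
  have hPM : P (n + k) := by
    by_contra hc
    have h3 := Nat.nth_count (p := fun m => 0 < m ∧ ¬ P m) (n := n + k) ⟨by omega, hc⟩
    rw [c] at h3
    omega
  have h5 := count_add_aux P (n + k - 1)
  rw [show n + k - 1 + 1 = n + k by omega, c] at h5
  have h6 := Nat.nth_count (p := fun m => 0 < m ∧ P m) (n := n + k) ⟨by omega, hPM⟩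
  rwa [show Nat.count (fun m => 0 < m ∧ P m) (n + k) = n - 1 by omega] at h6

theorem stmt_6 (P : ℕ → Prop)
    (hP : {m : ℕ | 0 < m ∧ P m}.Infinite)
    (hP' : {m : ℕ | 0 < m ∧ ¬ P m}.Infinite)
    (hgap : ∀ m : ℕ, 0 < m →
      m ≤ nthSat (fun x => ¬ P x) (m + 1) - nthSat (fun x => ¬ P x) m)
    (α : ℕ → ℝ)
    (hincr : ∀ m₁ m₂ : ℕ, 0 < m₁ → m₁ < m₂ → α m₁ < α m₂)
    (hα1 : α 1 = 1)
    (hα1' : α 1 ≤ (nthSat (fun x => ¬ P x) 1 : ℝ))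
    (hαlow : ∀ m : ℕ, 2 ≤ m → (nthSat (fun x => ¬ P x) (m - 1) : ℝ) ≤ α m)
    (hαhigh : ∀ m : ℕ, 2 ≤ m → α m ≤ (nthSat (fun x => ¬ P x) m : ℝ))
    (h : ℕ → ℕ)
    (hh : ∀ x : ℕ, 0 < x →
      0 < h x ∧ α (h x) ≤ (x : ℝ) ∧ ∀ m : ℕ, 0 < m → α m ≤ (x : ℝ) → m ≤ h x)
    (n : ℕ) (hn : 0 < n) :
    (n + h n ≥ nthSat (fun x => ¬ P x) (h n + 1) → nthSat P n = n + h n + 1) ∧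
    (n + h n ≤ nthSat (fun x => ¬ P x) (h n) → nthSat P n = n + h n - 1) ∧
    (nthSat (fun x => ¬ P x) (h n) < n + h n ∧
        n + h n < nthSat (fun x => ¬ P x) (h n + 1) →
      nthSat P n = n + h n) := by
  obtain ⟨h0, hle, hmax⟩ := hh n hn
  have hlt : n < nthSat (fun x => ¬ P x) (h n + 1) := by
    have h1 : (n : ℝ) < α (h n + 1) := by
      by_contra hc
      have := hmax (h n + 1) (by omega) (not_lt.1 hc)
      omega
    exact_mod_cast h1.trans_le (hαhigh (h n + 1) (by omega))
  refine ⟨fun hc => ?_, fun hc => ?_, fun hc => ?_⟩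
  · have hg := hgap (h n + 1) (by omega)
    exact key_aux P hP' n (h n + 1) hn (fun _ => by omega) (by omega)
  · have := key_aux P hP' n (h n - 1) hn (fun hk => by
      have h1 : nthSat (fun x => ¬ P x) (h n - 1) ≤ n := by
        exact_mod_cast (hαlow (h n) (by omega)).trans hle
      omega) (by rw [Nat.sub_add_cancel h0]; omega)
    omega
  · exact key_aux P hP' n (h n) hn (fun _ => hc.1) hc.2
end

section
/- Let P be a predicate on the positive integers such that both P and ¬P hold for infinitely many positive integers, and suppose f_{¬P}(m+1) − f_{¬P}(m) ≥ m for all positive integers m. Let α be a real-valued increasing function on the positive integers with α(1) = 1 and f_{¬P}(m−1) ≤ α(m) ≤ f_{¬P}(m) for all m ≥ 2 and α(1) ≤ f_{¬P}(1), and define h(n) = max{m ∈ ℕ⁺ : α(m) ≤ n}. If moreover f_{¬P}(m) − α(m) ≥ m for all integers m > 1, then for every positive integer n: f_P(n) = n + h(n) if n + h(n) > f_{¬P}(h(n)), and f_P(n) = n + h(n) − 1 otherwise. -/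
open Classical in
theorem count_aux_s8 (P : ℕ → Prop) (N : ℕ) :
    Nat.count (fun m => 0 < m ∧ P m) (N+1) + Nat.count (fun m => 0 < m ∧ ¬ P m) (N+1) = N := by
  induction N with
  | zero => simp [Nat.count_succ]
  | succ k ih =>
    rw [Nat.count_succ, Nat.count_succ (fun m => 0 < m ∧ ¬ P m)]
    by_cases hk : P (k+1) <;> simp [hk] <;> omega

open Classical in
theorem nth_aux (P : ℕ → Prop) (hP' : {m : ℕ | 0 < m ∧ ¬ P m}.Infinite) (n j : ℕ) (hn : 0 < n)
    (h1 : j = 0 ∨ nthSat (fun x => ¬ P x) j < n + j)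
    (h2 : n + j < nthSat (fun x => ¬ P x) (j + 1)) : nthSat P n = n + j := by
  unfold nthSat at *
  simp only [Nat.add_sub_cancel] at h2
  have hc : Nat.count (fun m => 0 < m ∧ ¬ P m) (n + j) = j := by
    apply le_antisymm
    · by_contra hlt
      push Not at hlt
      have := Nat.nth_lt_of_lt_count hlt
      omega
    · rcases h1 with h1 | h1
      · omega
      · by_contra hlt
        push Not at hlt
        have h3 : Nat.count (fun m => 0 < m ∧ ¬ P m) (n + j) ≤ j - 1 := by omega
        have h4 := (Nat.count_le_iff_le_nth hP').1 h3
        exact absurd h1 (not_lt.2 h4)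
  have hp : 0 < n + j ∧ P (n + j) := by
    refine ⟨by omega, ?_⟩
    by_contra hq
    have := Nat.nth_count (p := fun m => 0 < m ∧ ¬ P m) (n := n + j) ⟨by omega, hq⟩
    rw [hc] at this
    omega
  have hs := count_aux_s8 P (n + j - 1)
  rw [show n + j - 1 + 1 = n + j by omega, hc] at hs
  have := Nat.nth_count (p := fun m => 0 < m ∧ P m) (n := n + j) hp
  rwa [show Nat.count (fun m => 0 < m ∧ P m) (n + j) = n - 1 by omega] at this

theorem stmt_8 (P : ℕ → Prop)
    (hP : {m : ℕ | 0 < m ∧ P m}.Infinite)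
    (hP' : {m : ℕ | 0 < m ∧ ¬ P m}.Infinite)
    (hgap : ∀ m : ℕ, 0 < m →
      m ≤ nthSat (fun x => ¬ P x) (m + 1) - nthSat (fun x => ¬ P x) m)
    (α : ℕ → ℝ)
    (hincr : ∀ m₁ m₂ : ℕ, 0 < m₁ → m₁ < m₂ → α m₁ < α m₂)
    (hα1 : α 1 = 1)
    (hα1' : α 1 ≤ (nthSat (fun x => ¬ P x) 1 : ℝ))
    (hαlow : ∀ m : ℕ, 2 ≤ m → (nthSat (fun x => ¬ P x) (m - 1) : ℝ) ≤ α m)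
    (hαhigh : ∀ m : ℕ, 2 ≤ m → α m ≤ (nthSat (fun x => ¬ P x) m : ℝ))
    (h : ℕ → ℕ)
    (hh : ∀ x : ℕ, 0 < x →
      0 < h x ∧ α (h x) ≤ (x : ℝ) ∧ ∀ m : ℕ, 0 < m → α m ≤ (x : ℝ) → m ≤ h x)
    (hfar : ∀ m : ℕ, 1 < m → (m : ℝ) ≤ (nthSat (fun x => ¬ P x) m : ℝ) - α m)
    (n : ℕ) (hn : 0 < n) :
    (n + h n > nthSat (fun x => ¬ P x) (h n) → nthSat P n = n + h n) ∧
    (n + h n ≤ nthSat (fun x => ¬ P x) (h n) → nthSat P n = n + h n - 1) := by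
  obtain ⟨hk, hle, hmax⟩ := hh n hn
  generalize h n = k at *
  constructor
  · intro hc
    apply nth_aux P hP' n k hn (Or.inr hc)
    have h1 : (n : ℝ) < α (k + 1) := by
      by_contra hlt
      push Not at hlt
      have := hmax (k + 1) (by omega) hlt
      omega
    have h2 := hfar (k + 1) (by omega)
    push_cast at h2
    have h3 : (n : ℝ) + k < (nthSat (fun x => ¬ P x) (k + 1) : ℝ) := by linarith
    exact_mod_cast h3
  · intro hc
    obtain ⟨j, rfl⟩ : ∃ j, k = j + 1 := ⟨k - 1, by omega⟩
    have := nth_aux P hP' n j hn ?_ (by omega)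
    · omega
    · rcases Nat.eq_zero_or_pos j with h0 | h0
      · exact Or.inl h0
      · right
        have h1 := (hαlow (j + 1) (by omega)).trans hle
        rw [Nat.add_sub_cancel] at h1
        have h2 : nthSat (fun x => ¬ P x) j ≤ n := by exact_mod_cast h1
        omega
end

section
/- Fix an integer k ≥ 3 and let q = ⌊√(2n/(k−2))⌋. For every positive integer n, the n-th positive integer that is not a k-gonal number equals n + q + 1 if 2n > (k−2)·q·(q+1), and equals n + q otherwise; equivalently, it equals n + q + [2n > (k−2)·q·(q+1)], where [·] is the Iverson bracket. -/
def polyT (d m : ℕ) : ℕ := d * m * (m - 1) / 2 + m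

theorem polyT_succ (d m : ℕ) : polyT d (m + 1) = polyT d m + d * m + 1 := by
  unfold polyT
  have h : d * (m + 1) * (m + 1 - 1) = d * m * (m - 1) + (d * m) * 2 := by
    rcases m with _ | m
    · simp
    · simp only [Nat.add_sub_cancel]; ring
  rw [h, Nat.add_mul_div_right _ _ (by norm_num)]
  ring

theorem polyT_two (d m : ℕ) : 2 * polyT d m + d * m = d * m * m + 2 * m := by
  induction m with
  | zero => simp [polyT]
  | succ m ih => rw [polyT_succ]; nlinarith

theorem polyT_strictMono (d : ℕ) : StrictMono (polyT d) :=
  strictMono_nat_of_lt_succ (fun m => by rw [polyT_succ]; omega)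

def nonPoly (d x : ℕ) : Prop := 0 < x ∧ ¬∃ m : ℕ, 0 < m ∧ x = polyT d m

theorem nonPoly_of_between (d j x : ℕ) (h1 : polyT d j < x) (h2 : x < polyT d (j + 1)) :
    nonPoly d x := by
  refine ⟨by omega, ?_⟩
  rintro ⟨m, _, rfl⟩
  have a := (polyT_strictMono d).lt_iff_lt.1 h1
  have b := (polyT_strictMono d).lt_iff_lt.1 h2
  omega

theorem count_nonPoly (d : ℕ) [DecidablePred (nonPoly d)] (x : ℕ) :
    ∀ j, polyT d j < x → x ≤ polyT d (j + 1) → Nat.count (nonPoly d) x + j + 1 = x := by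
  induction x with
  | zero => intro j h; omega
  | succ x ih =>
    intro j h1 h2
    rw [Nat.count_succ]
    rcases Nat.lt_or_ge (polyT d j) x with h | h
    · rw [if_pos (nonPoly_of_between d j x h (by omega))]
      have := ih j h (by omega)
      omega
    · have hx : x = polyT d j := by omega
      rcases j with _ | j
      · have : x = 0 := by rw [hx]; simp [polyT]
        subst this
        simp [nonPoly]
      · have hn : ¬ nonPoly d x := fun hh => hh.2 ⟨j + 1, by omega, hx⟩
        rw [if_neg hn]
        have := ih j (by rw [hx]; exact polyT_strictMono d (by omega)) (by omega)
        omega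

theorem nth_nonPoly (d n j : ℕ) (hn : 0 < n) (h1 : d * j * j < 2 * n + d * j)
    (h2 : 2 * n ≤ d * j * (j + 1)) : Nat.nth (nonPoly d) (n - 1) = n + j := by
  classical
  have e := polyT_two d j
  have e1 := polyT_succ d j
  have h2' : 2 * n ≤ d * j * j + d * j := by linarith [mul_add (d * j) j 1]
  have a : polyT d j < n + j := by omega
  have b : n + j < polyT d (j + 1) := by omega
  have c := count_nonPoly d (n + j) j a b.le
  have c' : n - 1 = Nat.count (nonPoly d) (n + j) := by omega
  rw [c']
  exact Nat.nth_count (nonPoly_of_between d j _ a b)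

theorem stmt_9 (k : ℕ) (hk : 3 ≤ k) (n : ℕ) (hn : 0 < n)
    (q : ℕ) (hq : q = ⌊Real.sqrt (2 * (n : ℝ) / ((k : ℝ) - 2))⌋₊) :
    Nat.nth (fun x => 0 < x ∧ ¬∃ m : ℕ, 0 < m ∧ x = (k - 2) * m * (m - 1) / 2 + m)
        (n - 1) =
      n + q + (if 2 * n > (k - 2) * q * (q + 1) then 1 else 0) := by
  obtain ⟨d, rfl⟩ : ∃ d, k = d + 2 := ⟨k - 2, by omega⟩
  have hd : 0 < d := by omega
  simp only [Nat.add_sub_cancel]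
  have hdr : (0 : ℝ) < d := by exact_mod_cast hd
  have hcast : ((d + 2 : ℕ) : ℝ) - 2 = d := by push_cast; ring
  rw [hcast] at hq
  obtain ⟨l, u⟩ := (Nat.floor_eq_iff (Real.sqrt_nonneg _)).1 hq.symm
  have l1 : d * q * q ≤ 2 * n := by
    rw [Real.le_sqrt (by positivity) (by positivity), le_div_iff₀ hdr] at l
    have : ((d * q * q : ℕ) : ℝ) ≤ ((2 * n : ℕ) : ℝ) := by push_cast; nlinarith
    exact_mod_cast this
  have u1 : 2 * n < d * (q + 1) * (q + 1) := by
    rw [Real.sqrt_lt' (by positivity), div_lt_iff₀ hdr] at u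
    have : ((2 * n : ℕ) : ℝ) < ((d * (q + 1) * (q + 1) : ℕ) : ℝ) := by push_cast; nlinarith
    exact_mod_cast this
  change Nat.nth (nonPoly d) (n - 1) = _
  split_ifs with h
  · rw [add_assoc]
    exact nth_nonPoly d n (q + 1) hn (by nlinarith) (by nlinarith)
  · have hq0 : 0 < q := by
      rcases Nat.eq_zero_or_pos q with h0 | h0
      · subst h0; simp at h; omega
      · exact h0
    have := Nat.mul_pos hd hq0
    exact nth_nonPoly d n q hn (by omega) (by omega)
end

section
/- Fix an integer k with 3 ≤ k ≤ 10. For every positive integer n, the n-th positive integer that is not a k-gonal number equals n + ⌊√(2n/(k−2)) + 1/2⌋. -/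
lemma poly_two_mul (d m : ℕ) : 2 * (d * m * (m - 1) / 2) = d * m * (m - 1) := by
  apply Nat.mul_div_cancel'
  rw [mul_assoc]
  exact Dvd.dvd.mul_left (Nat.even_mul_pred_self m).two_dvd d

lemma poly_cast (d m : ℕ) :
    2 * ((d * m * (m - 1) / 2 : ℕ) : ℤ) = (d : ℤ) * m * (m - 1) := by
  have h := poly_two_mul d m
  rcases m with _ | m
  · simp
  · rw [← Int.natCast_inj] at h
    push_cast at h ⊢
    simpa using h

lemma poly_cast_succ (d m : ℕ) :
    2 * ((d * (m + 1) * (m + 1 - 1) / 2 : ℕ) : ℤ) = (d : ℤ) * (m + 1) * m := by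
  have h := poly_cast d (m + 1)
  rw [h]
  push_cast
  ring

lemma poly_strictMono (d : ℕ) : StrictMono (fun m : ℕ => d * m * (m - 1) / 2 + m) := by
  apply strictMono_nat_of_lt_succ
  intro m
  have h1 := poly_cast d m
  have h2 := poly_cast_succ d m
  have h3 : (0 : ℤ) ≤ (d : ℤ) * m := by positivity
  have h4 : (d : ℤ) * (m + 1) * m = d * m * (m - 1) + 2 * (d * m) := by ring
  generalize d * m * (m - 1) / 2 = a at *
  generalize d * (m + 1) * (m + 1 - 1) / 2 = b at *
  omega

lemma poly_nth (d n j : ℕ) (h1 : d * j * (j - 1) / 2 < n)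
    (h2 : n ≤ d * (j + 1) * (j + 1 - 1) / 2) :
    Nat.nth (fun x => 0 < x ∧ ¬∃ m : ℕ, 0 < m ∧ x = d * m * (m - 1) / 2 + m) (n - 1) = n + j := by
  classical
  have hm := poly_strictMono d
  set T : ℕ → ℕ := fun m : ℕ => d * m * (m - 1) / 2 + m with hT
  have hT0 : T 0 = 0 := by simp [hT]
  have l1 : T j < n + j := by simp only [hT]; omega
  have l2 : n + j < T (j + 1) := by simp only [hT]; omega
  set p : ℕ → Prop := fun x => 0 < x ∧ ¬∃ m : ℕ, 0 < m ∧ x = T m with hp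
  have hnp : ∀ x, ¬ p x ↔ ∃ m, x = T m := by
    intro x
    simp only [hp]
    constructor
    · intro h
      by_cases hx : 0 < x
      · by_contra hc
        exact h ⟨hx, fun ⟨m, _, h⟩ => hc ⟨m, h⟩⟩
      · exact ⟨0, by omega⟩
    · rintro ⟨m, rfl⟩ ⟨h0, h⟩
      rcases Nat.eq_zero_or_pos m with rfl | hm0
      · omega
      · exact h ⟨m, hm0, rfl⟩
  clear_value p
  have hpx : p (n + j) := by
    by_contra h
    obtain ⟨m, h⟩ := (hnp _).1 h
    rw [h] at l1 l2
    have := hm.lt_iff_lt.1 l1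
    have := hm.lt_iff_lt.1 l2
    omega
  have himg : (Finset.range (n + j)).filter (fun x => ¬ p x) = (Finset.range (j + 1)).image T := by
    ext x
    simp only [Finset.mem_filter, Finset.mem_range, Finset.mem_image, hnp]
    constructor
    · rintro ⟨hx, m, rfl⟩
      exact ⟨m, hm.lt_iff_lt.1 (hx.trans l2), rfl⟩
    · rintro ⟨m, hmj, rfl⟩
      exact ⟨(hm.monotone (Nat.lt_succ_iff.1 hmj)).trans_lt l1, m, rfl⟩
  have hc : Nat.count p (n + j) = n - 1 := by
    have := Finset.card_filter_add_card_filter_not (s := Finset.range (n + j)) p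
    rw [himg, Finset.card_image_of_injective _ hm.injective, Finset.card_range, Finset.card_range,
      ← Nat.count_eq_card_filter_range] at this
    omega
  have := Nat.nth_count hpx
  rwa [hc] at this

theorem stmt_10 (k : ℕ) (hk3 : 3 ≤ k) (hk10 : k ≤ 10) (n : ℕ) (hn : 0 < n) :
    Nat.nth (fun x => 0 < x ∧ ¬∃ m : ℕ, 0 < m ∧ x = (k - 2) * m * (m - 1) / 2 + m)
        (n - 1) =
      n + ⌊Real.sqrt (2 * (n : ℝ) / ((k : ℝ) - 2)) + 1 / 2⌋₊ := by
  obtain ⟨d, rfl⟩ : ∃ d, k = d + 2 := ⟨k - 2, by omega⟩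
  have hd : ((d + 2 : ℕ) : ℝ) - 2 = d := by push_cast; ring
  rw [hd, Nat.add_sub_cancel]
  have hd0 : (0 : ℝ) < d := by exact_mod_cast (by omega : 0 < d)
  set s := Real.sqrt (2 * (n : ℝ) / d) with hs
  have hs0 : 0 ≤ s := Real.sqrt_nonneg _
  have hss : d * s ^ 2 = 2 * n := by
    rw [hs, Real.sq_sqrt (by positivity)]; field_simp
  set j := ⌊s + 1 / 2⌋₊ with hj
  have a1 : (j : ℝ) ≤ s + 1 / 2 := Nat.floor_le (by positivity)
  have a2 : s + 1 / 2 < j + 1 := Nat.lt_floor_add_one _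
  have c1 := poly_cast d j
  have c2 := poly_cast_succ d j
  have b2 : (8 * n : ℝ) < d * (4 * (j + 1) * j + 1) := by
    have : s ^ 2 < (j + 1 / 2) ^ 2 := by
      apply pow_lt_pow_left₀ _ hs0 (by norm_num)
      linarith
    nlinarith
  have b2' : (8 * n : ℤ) < d * (4 * (j + 1) * j + 1) := by exact_mod_cast b2
  have e2 : n ≤ d * (j + 1) * (j + 1 - 1) / 2 := by
    have : (d : ℤ) * (4 * (j + 1) * j + 1) = 4 * (d * (j + 1) * j) + d := by ring
    clear_value j
    generalize d * (j + 1) * (j + 1 - 1) / 2 = b at *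
    omega
  have hj1 : 1 ≤ j := by
    rcases Nat.eq_zero_or_pos j with h | h
    · rw [h] at e2; simp at e2; omega
    · exact h
  have b1 : (d * (4 * j * (j - 1) + 1) : ℝ) ≤ 8 * n := by
    have hj1' : (1 : ℝ) ≤ j := by exact_mod_cast hj1
    have : ((j : ℝ) - 1 / 2) ^ 2 ≤ s ^ 2 := by
      apply pow_le_pow_left₀ <;> linarith
    nlinarith
  have b1' : (d * (4 * j * (j - 1) + 1) : ℤ) ≤ 8 * n := by exact_mod_cast b1
  apply poly_nth d n j _ e2
  have : (d : ℤ) * (4 * j * (j - 1) + 1) = 4 * (d * j * (j - 1)) + d := by ring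
  clear_value j
  generalize d * j * (j - 1) / 2 = b at *
  omega
end

section
/- For every positive integer n, the n-th positive integer that is not a triangular number equals n + ⌊√(2n) + 1/2⌋, and the n-th positive integer that is not a perfect square equals n + ⌊√n + 1/2⌋. -/
theorem aux_count_s11 (f : ℕ → ℕ) (hf : StrictMono f) (h0 : f 0 = 0) (p : ℕ → Prop)
    [DecidablePred p] (hp : ∀ x, p x ↔ 0 < x ∧ ¬∃ m : ℕ, 0 < m ∧ x = f m) :
    ∀ x k, f k < x → x ≤ f (k + 1) → Nat.count p x + k + 1 = x := by
  intro x
  induction x with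
  | zero => intro k h; omega
  | succ y ih =>
    intro k h1 h2
    rw [Nat.count_succ]
    by_cases hy : y = f k
    · rcases k with _ | k
      · have hy0 : y = 0 := by omega
        subst hy0
        have : ¬ p 0 := by rw [hp]; simp
        simp [this]
      · have := ih k (by rw [hy]; exact hf (Nat.lt_succ_self k)) hy.le
        have hn : ¬ p y := by
          rw [hp]
          rintro ⟨-, h⟩
          exact h ⟨k + 1, by omega, hy⟩
        rw [if_neg hn]
        omega
    · have := ih k (by omega) (by omega)
      have hn : p y := by
        rw [hp]
        refine ⟨by omega, ?_⟩
        rintro ⟨m, -, rfl⟩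
        have a : k < m := hf.lt_iff_lt.1 (by omega)
        have b : m < k + 1 := hf.lt_iff_lt.1 (by omega)
        omega
      rw [if_pos hn]
      omega

theorem aux_nth_s11 (f : ℕ → ℕ) (hf : StrictMono f) (h0 : f 0 = 0) (n k : ℕ) (hn : 0 < n)
    (h1 : f k < n + k) (h2 : n + k < f (k + 1)) :
    Nat.nth (fun x => 0 < x ∧ ¬∃ m : ℕ, 0 < m ∧ x = f m) (n - 1) = n + k := by
  classical
  have hc := aux_count_s11 f hf h0 (fun x => 0 < x ∧ ¬∃ m : ℕ, 0 < m ∧ x = f m)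
    (fun _ => Iff.rfl) (n + k) k h1 h2.le
  have hk : n - 1 = Nat.count (fun x => 0 < x ∧ ¬∃ m : ℕ, 0 < m ∧ x = f m) (n + k) := by omega
  rw [hk]
  apply Nat.nth_count
  refine ⟨by omega, ?_⟩
  rintro ⟨m, -, h⟩
  have a : k < m := hf.lt_iff_lt.1 (by omega)
  have b : m < k + 1 := hf.lt_iff_lt.1 (by omega)
  omega

theorem aux_floor (N : ℕ) (hN : 0 < N) (k : ℕ) (hk : k = ⌊Real.sqrt (N : ℝ) + 1 / 2⌋₊) :
    k * k < N + k ∧ N ≤ k * k + k := by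
  have hs := Real.sqrt_nonneg (N : ℝ)
  have hq := Real.mul_self_sqrt (Nat.cast_nonneg (α := ℝ) N)
  have h1 : (k : ℝ) ≤ Real.sqrt (N : ℝ) + 1 / 2 := by
    rw [hk]; exact Nat.floor_le (by positivity)
  have h2 : Real.sqrt (N : ℝ) + 1 / 2 < (k : ℝ) + 1 := by
    rw [hk]; exact Nat.lt_floor_add_one _
  generalize Real.sqrt (N : ℝ) = s at *
  constructor
  · rcases Nat.eq_zero_or_pos k with h | h
    · subst h; omega
    · have h' : (1 : ℝ) ≤ k := by exact_mod_cast h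
      have : (k : ℝ) * k < N + k := by nlinarith
      exact_mod_cast this
  · have : (N : ℝ) < k * k + k + 1 := by nlinarith
    have : N < k * k + k + 1 := by exact_mod_cast this
    omega

theorem aux_tri (m : ℕ) : 2 * (m * (m + 1) / 2) = m * (m + 1) :=
  Nat.mul_div_cancel' (Nat.even_mul_succ_self m).two_dvd

theorem stmt_11 (n : ℕ) (hn : 0 < n) :
    Nat.nth (fun x => 0 < x ∧ ¬∃ m : ℕ, 0 < m ∧ x = m * (m + 1) / 2) (n - 1) =
        n + ⌊Real.sqrt (2 * (n : ℝ)) + 1 / 2⌋₊ ∧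
    Nat.nth (fun x => 0 < x ∧ ¬∃ m : ℕ, 0 < m ∧ x = m ^ 2) (n - 1) =
        n + ⌊Real.sqrt (n : ℝ) + 1 / 2⌋₊ := by
  constructor
  · obtain ⟨h1, h2⟩ := aux_floor (2 * n) (by omega) _ rfl
    push_cast at h1 h2
    generalize ⌊Real.sqrt (2 * (n : ℝ)) + 1 / 2⌋₊ = k at *
    have t1 := aux_tri k
    have t2 := aux_tri (k + 1)
    refine aux_nth_s11 (fun m => m * (m + 1) / 2) ?_ rfl n k hn ?_ ?_
    · apply strictMono_nat_of_lt_succ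
      intro m
      have a := aux_tri m
      have b := aux_tri (m + 1)
      nlinarith
    · show _ < _
      nlinarith
    · show _ < _
      nlinarith
  · obtain ⟨h1, h2⟩ := aux_floor n hn _ rfl
    generalize ⌊Real.sqrt (n : ℝ) + 1 / 2⌋₊ = k at *
    refine aux_nth_s11 (fun m => m ^ 2) ?_ rfl n k hn ?_ ?_
    · apply strictMono_nat_of_lt_succ
      intro m
      exact Nat.pow_lt_pow_left (Nat.lt_succ_self m) (by norm_num)
    · show _ < _
      nlinarith
    · show _ < _
      nlinarith
end

section
/- For every positive integer n, ⌊1/2 + √n⌋ = ⌊√(n + ⌊√n⌋)⌋; consequently the two formulas n + ⌊1/2 + √n⌋ and n + ⌊√(n + ⌊√n⌋)⌋ for the n-th positive nonsquare number agree. -/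
theorem stmt_12 (n : ℕ) (hn : 0 < n) :
    ⌊1 / 2 + Real.sqrt (n : ℝ)⌋₊ = Nat.sqrt (n + Nat.sqrt n) ∧
    n + ⌊1 / 2 + Real.sqrt (n : ℝ)⌋₊ = n + Nat.sqrt (n + Nat.sqrt n) := by
  have key : ⌊1 / 2 + Real.sqrt (n : ℝ)⌋₊ = Nat.sqrt (n + Nat.sqrt n) := by
    have h1 := Nat.sqrt_le n
    have h2 := Nat.lt_succ_sqrt n
    have h3 := Nat.sqrt_le (n + Nat.sqrt n)
    have h4 := Nat.lt_succ_sqrt (n + Nat.sqrt n)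
    have h5 : 0 < Nat.sqrt n := Nat.sqrt_pos.2 hn
    have h6 : Nat.sqrt n ≤ Nat.sqrt (n + Nat.sqrt n) := Nat.sqrt_le_sqrt (by omega)
    generalize Nat.sqrt (n + Nat.sqrt n) = m at *
    generalize Nat.sqrt n = s at *
    simp only [Nat.succ_eq_add_one] at h2 h4
    have h7 : m ≤ s + 1 := by
      by_contra h
      have : s + 2 ≤ m := by omega
      nlinarith
    have ha : m * m + 1 ≤ n + m := by
      obtain h | h : m = s ∨ m = s + 1 := by omega
      · subst h; nlinarith
      · subst h; nlinarith
    have hb : n ≤ m * m + m := by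
      obtain h | h : m = s ∨ m = s + 1 := by omega
      · subst h; nlinarith
      · subst h; nlinarith
    have ha' : (m : ℝ) * m + 1 ≤ n + m := by exact_mod_cast ha
    have hb' : (n : ℝ) ≤ m * m + m := by exact_mod_cast hb
    rw [Nat.floor_eq_iff (by positivity)]
    constructor
    · have : (m : ℝ) - 1 / 2 ≤ Real.sqrt n := Real.le_sqrt_of_sq_le (by nlinarith)
      linarith
    · have : Real.sqrt n < (m : ℝ) + 1 / 2 := by
        rw [Real.sqrt_lt' (by positivity)]
        nlinarith
      linarith
  exact ⟨key, by rw [key]⟩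
end

section
/- Fix an integer k with 3 ≤ k ≤ 8 and let c = ⌊(6n/(k−2))^{1/3}⌋. For every positive integer n, the n-th positive integer that is not a k-gonal pyramidal number equals: n + c + 1 if 6n ≥ c³(k−2) + 3c²(k−1) + c(2k−1) + 6; n + c − 1 if 6n ≤ c(c−1)(c(k−2) + k + 1); and n + c otherwise. -/
/-- If `p` is strictly increasing with `p 0 = 0` and `p j < n + j < p (j+1)`, then the `n`-th positive
integer outside the values of `p` is `n + j`. -/
theorem nth_aux_s14 (p : ℕ → ℕ) (hp : StrictMono p) (h0 : p 0 = 0) (n j : ℕ) (hn : 0 < n)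
    (h1 : p j < n + j) (h2 : n + j < p (j + 1)) :
    Nat.nth (fun x => 0 < x ∧ ¬∃ m : ℕ, 0 < m ∧ x = p m) (n - 1) = n + j := by
  classical
  have hP : (fun x => 0 < x ∧ ¬∃ m : ℕ, 0 < m ∧ x = p m) = fun x => ¬ ∃ m, p m = x := by
    funext x
    apply propext
    constructor
    · rintro ⟨hx, h⟩ ⟨m, hm⟩
      apply h
      refine ⟨m, ?_, hm.symm⟩
      rcases Nat.eq_zero_or_pos m with rfl | h'
      · omega
      · exact h'
    · intro h
      refine ⟨?_, ?_⟩
      · rcases Nat.eq_zero_or_pos x with rfl | h'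
        · exact absurd ⟨0, h0⟩ h
        · exact h'
      · rintro ⟨m, _, hm⟩
        exact h ⟨m, hm.symm⟩
  rw [hP]
  have hcard : ((Finset.range (n + j)).filter (fun x => ∃ m, p m = x)).card = j + 1 := by
    have : (Finset.range (n + j)).filter (fun x => ∃ m, p m = x) =
        (Finset.range (j + 1)).image p := by
      ext x
      simp only [Finset.mem_filter, Finset.mem_range, Finset.mem_image]
      constructor
      · rintro ⟨hx, m, rfl⟩
        exact ⟨m, hp.lt_iff_lt.1 (hx.trans h2), rfl⟩
      · rintro ⟨m, hm, rfl⟩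
        exact ⟨lt_of_le_of_lt (hp.monotone (by omega)) h1, m, rfl⟩
    rw [this, Finset.card_image_of_injective _ hp.injective, Finset.card_range]
  have hcount : Nat.count (fun x => ¬ ∃ m, p m = x) (n + j) = n - 1 := by
    rw [Nat.count_eq_card_filter_range]
    have := Finset.card_filter_add_card_filter_not (s := Finset.range (n + j))
      (fun x => ∃ m, p m = x)
    rw [hcard, Finset.card_range] at this
    omega
  rw [← hcount]
  apply Nat.nth_count
  rintro ⟨m, hm⟩
  have a1 : j < m := hp.lt_iff_lt.1 (by omega)
  have a2 : m < j + 1 := hp.lt_iff_lt.1 (by omega)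
  omega

theorem six_dvd_aux (a t : ℕ) : 6 ∣ (t + 1) * (t + 2) * (t * a + 3) := by
  induction t with
  | zero => norm_num
  | succ t ih =>
    obtain ⟨q, hq⟩ := ih
    obtain ⟨r, hr⟩ := Nat.even_mul_succ_self (t + 1)
    refine ⟨q + r * a + (t + 2), ?_⟩
    have e : (t + 1 + 1) * (t + 1 + 2) * ((t + 1) * a + 3)
      = (t + 1) * (t + 2) * (t * a + 3) + 3 * a * ((t + 1) * (t + 1 + 1)) + 6 * (t + 2) := by ring
    rw [e, hq, hr]; ring

theorem pyr_succ (a t : ℕ) :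
    6 * ((t + 1) * (t + 1 + 1) * ((t + 1) * (a + 2 - 2) + 5 - (a + 2)) / 6)
      = (t + 1) * (t + 2) * (t * a + 3) := by
  have : (t + 1) * (a + 2 - 2) + 5 - (a + 2) = t * a + 3 := by
    have : (t + 1) * (a + 2 - 2) = t * a + a := by
      rw [Nat.add_sub_cancel]; ring
    omega
  rw [this]
  exact Nat.mul_div_cancel' (six_dvd_aux a t)


theorem stmt_14 (k : ℕ) (hk3 : 3 ≤ k) (hk8 : k ≤ 8) (n : ℕ) (hn : 0 < n)
    (c : ℕ) (hc : c = ⌊(6 * (n : ℝ) / ((k : ℝ) - 2)) ^ ((1 : ℝ) / 3)⌋₊) :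
    ((6 * n ≥ c ^ 3 * (k - 2) + 3 * c ^ 2 * (k - 1) + c * (2 * k - 1) + 6 →
      Nat.nth (fun x => 0 < x ∧
          ¬∃ m : ℕ, 0 < m ∧ x = m * (m + 1) * (m * (k - 2) + 5 - k) / 6) (n - 1)
        = n + c + 1) ∧
    (6 * n ≤ c * (c - 1) * (c * (k - 2) + k + 1) →
      Nat.nth (fun x => 0 < x ∧
          ¬∃ m : ℕ, 0 < m ∧ x = m * (m + 1) * (m * (k - 2) + 5 - k) / 6) (n - 1)
        = n + c - 1) ∧
    (6 * n < c ^ 3 * (k - 2) + 3 * c ^ 2 * (k - 1) + c * (2 * k - 1) + 6 ∧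
        c * (c - 1) * (c * (k - 2) + k + 1) < 6 * n →
      Nat.nth (fun x => 0 < x ∧
          ¬∃ m : ℕ, 0 < m ∧ x = m * (m + 1) * (m * (k - 2) + 5 - k) / 6) (n - 1)
        = n + c)) := by


  obtain ⟨a, rfl⟩ : ∃ a, k = a + 2 := ⟨k - 2, by omega⟩
  have ha1 : 1 ≤ a := by omega
  have ha6 : a ≤ 6 := by omega
  -- bounds on c
  have hapos : (0 : ℝ) < a := by exact_mod_cast ha1
  have hx : (6 * (n : ℝ) / (((a + 2 : ℕ) : ℝ) - 2)) = 6 * (n : ℝ) / a := by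
    push_cast; congr 1; ring
  rw [hx] at hc
  set x : ℝ := 6 * (n : ℝ) / a with hxdef
  have hx0 : 0 ≤ x := by positivity
  have hcube : (x ^ ((1 : ℝ) / 3)) ^ 3 = x := by
    rw [← Real.rpow_natCast, ← Real.rpow_mul hx0]; norm_num
  have hy0 : 0 ≤ x ^ ((1 : ℝ) / 3) := by positivity
  have hxa : x * a = 6 * n := by rw [hxdef]; field_simp
  have hlo : c ^ 3 * a ≤ 6 * n := by
    have h : (c : ℝ) ≤ x ^ ((1 : ℝ) / 3) := by rw [hc]; exact Nat.floor_le hy0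
    have h3 : (c : ℝ) ^ 3 ≤ x := by rw [← hcube]; gcongr
    have : (c : ℝ) ^ 3 * a ≤ 6 * n := by rw [← hxa]; gcongr
    exact_mod_cast this
  have hhi : 6 * n < (c + 1) ^ 3 * a := by
    have h : x ^ ((1 : ℝ) / 3) < c + 1 := by rw [hc]; exact Nat.lt_floor_add_one _
    have h3 : x < ((c : ℝ) + 1) ^ 3 := by rw [← hcube]; gcongr
    have : 6 * (n : ℝ) < ((c : ℝ) + 1) ^ 3 * a := by rw [← hxa]; gcongr
    exact_mod_cast this
  have hc1 : 1 ≤ c := by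
    rcases Nat.eq_zero_or_pos c with rfl | h
    · norm_num at hhi; omega
    · exact h
  clear_value x
  clear hc hcube hy0 hxa hx0 hx
  obtain ⟨d, rfl⟩ : ∃ d, c = d + 1 := ⟨c - 1, by omega⟩
  set p : ℕ → ℕ := fun m => m * (m + 1) * (m * (a + 2 - 2) + 5 - (a + 2)) / 6 with hpdef
  have hp0 : p 0 = 0 := by simp [hpdef]
  have hps : ∀ t, 6 * p (t + 1) = (t + 1) * (t + 2) * (t * a + 3) := fun t => pyr_succ a t
  have hmono : StrictMono p := by
    apply strictMono_nat_of_lt_succ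
    intro m
    rcases m with _ | t
    · have := hps 0
      omega
    · have e1 := hps t
      have e2 := hps (t + 1)
      have : (t + 1) * (t + 2) * (t * a + 3) < (t + 1 + 1) * (t + 1 + 2) * ((t + 1) * a + 3) := by
        gcongr <;> omega
      omega
  have key := fun j => nth_aux_s14 p hmono hp0 n j hn
  have s1 := hps d
  have s2 := hps (d + 1)
  have s3 := hps (d + 2)
  have f1 : a + 2 - 1 = a + 1 := by omega
  have f2 : 2 * (a + 2) - 1 = 2 * a + 3 := by omega
  have f3 : d + 1 - 1 = d := by omega
  have f4 : a + 2 - 2 = a := by omega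
  rw [f1, f2, f3, f4]
  rw [f4] at hpdef
  refine ⟨fun h => ?_, fun h => ?_, fun h => ?_⟩
  · rw [add_assoc n (d + 1) 1, ← key (d + 1 + 1) ?_ ?_]
    · simp only [hpdef]
    · linarith
    · have : 6 * (n + (d + 1 + 1)) < 6 * p (d + 1 + 1 + 1) := by
        rw [s3]
        have : 0 ≤ d * d * a + d * a := by positivity
        nlinarith
      omega
  · have hh : n + (d + 1) - 1 = n + d := by omega
    rw [hh, ← key d ?_ ?_]
    · simp only [hpdef]
    · rcases d with _ | e
      · omega
      · have s0 := hps e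
        have : 6 * p (e + 1) < 6 * (n + (e + 1)) := by
          rw [s0]
          have : e * e ≤ e * e * a := Nat.le_mul_of_pos_right _ ha1
          have : e ≤ e * a := Nat.le_mul_of_pos_right _ ha1
          nlinarith
        omega
    · linarith
  · obtain ⟨h1, h2⟩ := h
    rw [← key (d + 1) ?_ ?_]
    · simp only [hpdef]
    · linarith
    · have : 6 * (n + (d + 1)) < 6 * p (d + 1 + 1) := by
        rw [s2]
        linarith
      omega
end

section
/- Fix an integer k > 1 and let h = ⌊((k+1)n)^{1/(k+1)}⌋. For every positive integer n, the n-th positive integer that is not a sum of the first consecutive k-th powers (i.e., not of the form Σ_{i=1}^m i^k for some positive integer m) equals n + h if n + h > Σ_{i=1}^{h} i^k, and equals n + h − 1 otherwise. -/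
def SS (k m : ℕ) : ℕ := ∑ i ∈ Finset.Icc 1 m, i ^ k

def PP (k : ℕ) (x : ℕ) : Prop :=
  0 < x ∧ ¬∃ m : ℕ, 0 < m ∧ x = ∑ i ∈ Finset.Icc 1 m, i ^ k

theorem SS_zero (k : ℕ) : SS k 0 = 0 := by simp [SS]

theorem SS_succ (k m : ℕ) : SS k (m + 1) = SS k m + (m + 1) ^ k := by
  unfold SS
  rw [Finset.sum_Icc_succ_top (by omega)]

theorem SS_strictMono (k : ℕ) : StrictMono (SS k) := by
  apply strictMono_nat_of_lt_succ
  intro m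
  rw [SS_succ]
  have : 0 < (m + 1) ^ k := by positivity
  omega

theorem aux1 (a k : ℕ) : a * (a + 1) ^ k ≤ a ^ (k + 1) + k * (a + 1) ^ k := by
  induction k with
  | zero => simp
  | succ k ih =>
    have h1 : a ^ (k + 1) ≤ (a + 1) ^ (k + 1) := Nat.pow_le_pow_left (by omega) _
    have h2 := Nat.mul_le_mul_right (a + 1) ih
    calc a * (a + 1) ^ (k + 1) = a * (a + 1) ^ k * (a + 1) := by ring
      _ ≤ _ := h2
      _ = a ^ (k + 2) + a ^ (k + 1) + k * (a + 1) ^ (k + 1) := by ring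
      _ ≤ a ^ (k + 2) + (a + 1) ^ (k + 1) + k * (a + 1) ^ (k + 1) := by omega
      _ = _ := by ring

theorem trap (a k : ℕ) (hk : 1 ≤ k) :
    2 * (a + 1) ^ (k + 1) ≤ 2 * a ^ (k + 1) + (k + 1) * (a ^ k + (a + 1) ^ k) := by
  induction k, hk using Nat.le_induction with
  | base => exact le_of_eq (by ring)
  | succ k hk ih =>
    have h1 := aux1 a k
    have h2 := Nat.mul_le_mul_left a ih
    zify at *
    ring_nf at *
    nlinarith

theorem lowerS (k m : ℕ) (hk : 1 ≤ k) :
    2 * m ^ (k + 1) + (k + 1) * m ^ k ≤ 2 * (k + 1) * SS k m := by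
  induction m with
  | zero => simp [SS_zero]; omega
  | succ m ih =>
    rw [SS_succ]
    have := trap m k hk
    nlinarith

theorem bern (c k : ℕ) : c ^ (k + 1) + (k + 1) * c ^ k ≤ (c + 1) ^ (k + 1) := by
  induction k with
  | zero => simp
  | succ k ih =>
    have h2 := Nat.mul_le_mul_right (c + 1) ih
    calc _ ≤ (c ^ (k + 1) + (k + 1) * c ^ k) * (c + 1) := by
            ring_nf
            nlinarith [Nat.zero_le (c ^ k), Nat.zero_le (k * c ^ k)]
      _ ≤ _ := h2
      _ = _ := by ring

theorem upperS (k m : ℕ) : (k + 1) * SS k m ≤ (m + 1) ^ (k + 1) := by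
  induction m with
  | zero => simp [SS_zero]
  | succ m ih =>
    rw [SS_succ]
    have := bern (m + 1) k
    nlinarith

theorem PP_between (k m x : ℕ) (h1 : SS k m < x) (h2 : x < SS k (m + 1)) : PP k x := by
  refine ⟨by omega, ?_⟩
  rintro ⟨r, _, hr⟩
  change x = SS k r at hr
  subst hr
  have a := (SS_strictMono k).lt_iff_lt.1 h1
  have b := (SS_strictMono k).lt_iff_lt.1 h2
  omega

open Classical in
theorem count_PP (k m : ℕ) : ∀ j, SS k m + 1 + j ≤ SS k (m + 1) →
    Nat.count (PP k) (SS k m + 1 + j) + m = SS k m + j := by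
  induction m with
  | zero =>
    intro j
    induction j with
    | zero => intro _; simp [SS_zero, Nat.count_succ, PP]
    | succ j ih =>
      intro hj
      have := ih (by omega)
      have hp := PP_between k 0 (SS k 0 + 1 + j) (by omega) (by omega)
      rw [← add_assoc (SS k _ + 1) j 1, Nat.count_succ, if_pos hp]
      omega
  | succ m ihm =>
    intro j
    induction j with
    | zero =>
      intro _
      have hlt : SS k m < SS k (m + 1) := SS_strictMono k (by omega)
      have := ihm (SS k (m + 1) - SS k m - 1) (by omega)
      rw [show SS k m + 1 + (SS k (m + 1) - SS k m - 1) = SS k (m + 1) by omega] at this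
      have hp : ¬ PP k (SS k (m + 1)) := fun h => h.2 ⟨m + 1, by omega, rfl⟩
      rw [add_zero, Nat.count_succ, if_neg hp]
      omega
    | succ j ih =>
      intro hj
      have := ih (by omega)
      have hp := PP_between k (m + 1) (SS k (m + 1) + 1 + j) (by omega) (by omega)
      rw [← add_assoc (SS k _ + 1) j 1, Nat.count_succ, if_pos hp]
      omega

theorem nth_PP (k m n : ℕ) (h1 : SS k m < n + m) (h2 : n + m < SS k (m + 1)) :
    Nat.nth (PP k) (n - 1) = n + m := by
  classical
  have hp := PP_between k m (n + m) h1 h2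
  have hc := count_PP k m (n + m - SS k m - 1) (by omega)
  rw [show SS k m + 1 + (n + m - SS k m - 1) = n + m by omega] at hc
  have := Nat.nth_count hp
  rwa [show Nat.count (PP k) (n + m) = n - 1 by omega] at this

theorem stmt_16 (k : ℕ) (hk : 1 < k) (n : ℕ) (hn : 0 < n)
    (h : ℕ) (hh : h = ⌊(((k + 1) * n : ℕ) : ℝ) ^ ((1 : ℝ) / (k + 1))⌋₊) :
    Nat.nth (fun x => 0 < x ∧ ¬∃ m : ℕ, 0 < m ∧ x = ∑ i ∈ Finset.Icc 1 m, i ^ k)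
        (n - 1) =
      if n + h > ∑ i ∈ Finset.Icc 1 h, i ^ k then n + h else n + h - 1 := by
  change Nat.nth (PP k) (n - 1) = if n + h > SS k h then n + h else n + h - 1
  have hy : ((((k + 1) * n : ℕ) : ℝ) ^ ((1 : ℝ) / (k + 1))) ^ (k + 1)
      = (((k + 1) * n : ℕ) : ℝ) := by
    rw [← Real.rpow_natCast, ← Real.rpow_mul (by positivity)]
    push_cast
    rw [one_div_mul_cancel (by positivity), Real.rpow_one]
  have hy0 : 0 ≤ (((k + 1) * n : ℕ) : ℝ) ^ ((1 : ℝ) / (k + 1)) := by positivity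
  generalize (((k + 1) * n : ℕ) : ℝ) ^ ((1 : ℝ) / (k + 1)) = y at *
  have e1 : h ^ (k + 1) ≤ (k + 1) * n := by
    have : (h : ℝ) ≤ y := hh ▸ Nat.floor_le hy0
    have := pow_le_pow_left₀ (by positivity) this (k + 1)
    rw [hy] at this
    exact_mod_cast this
  have e2 : (k + 1) * n < (h + 1) ^ (k + 1) := by
    have : y < (h : ℝ) + 1 := hh ▸ Nat.lt_floor_add_one y
    have := pow_lt_pow_left₀ this hy0 (Nat.succ_ne_zero k)
    rw [Nat.succ_eq_add_one, hy] at this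
    exact_mod_cast this
  clear hh hy hy0
  have hpos : 1 ≤ h := by
    by_contra hc
    have : h = 0 := by omega
    subst this
    simp at e2
    omega
  split_ifs with hc
  · apply nth_PP k h n hc
    have l := lowerS k (h + 1) (by omega)
    have q : 2 * (h + 1) ≤ (h + 1) ^ k := by
      calc 2 * (h + 1) ≤ (h + 1) ^ 2 := by nlinarith
        _ ≤ _ := Nat.pow_le_pow_right (by omega) hk
    have q2 := Nat.mul_le_mul_left (k + 1) q
    have : (k + 1) * (n + (h + 1)) < (k + 1) * SS k (h + 1) := by nlinarith
    have := Nat.lt_of_mul_lt_mul_left this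
    omega
  · obtain ⟨g, rfl⟩ : ∃ g, h = g + 1 := ⟨h - 1, by omega⟩
    have u := upperS k g
    have u2 : SS k g ≤ n := Nat.le_of_mul_le_mul_left (u.trans e1) (by omega)
    rw [show n + (g + 1) - 1 = n + g by omega]
    apply nth_PP k g n
    · rcases Nat.eq_zero_or_pos g with rfl | hg
      · rw [SS_zero]; omega
      · omega
    · omega
end

section
/- Fix a positive integer k, and let r = ⌊(k²−4k+6)/4⌋ if k is even and r = ⌊(k²−6k+11)/4⌋ if k is odd. Then for every positive integer n with n ≥ r, (n + ⌊k/2⌋ − 1)^k ≤ n·(n+1)·⋯·(n+k−1) ≤ (n + ⌊k/2⌋)^k. -/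
theorem prod_two_step (k n : ℕ) : ∏ i ∈ Finset.range (k + 2), (n + i) =
    (∏ i ∈ Finset.range k, (n + 1 + i)) * (n * (n + k + 1)) := by
  rw [Finset.prod_range_succ, Finset.prod_range_succ']
  have : ∀ i ∈ Finset.range k, n + (i + 1) = n + 1 + i := fun i _ => by ring
  rw [Finset.prod_congr rfl this]
  ring

theorem lower_even (m : ℕ) : ∀ n N : ℕ, N + 1 = n + m → m * m + 1 ≤ n + 2 * m →
    N ^ (2 * m) ≤ ∏ i ∈ Finset.range (2 * m), (n + i) := by
  induction m with
  | zero => intro n N _ _; simp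
  | succ m ih =>
    intro n N h1 h2
    rw [show 2 * (m + 1) = 2 * m + 2 by ring, prod_two_step, pow_add]
    refine Nat.mul_le_mul (ih (n + 1) N (by omega) (by nlinarith)) ?_
    obtain rfl : N = n + m := by omega
    nlinarith

theorem upper_even (m : ℕ) : ∀ n N : ℕ, N = n + m →
    ∏ i ∈ Finset.range (2 * m), (n + i) ≤ N ^ (2 * m) := by
  induction m with
  | zero => intro n N _; simp
  | succ m ih =>
    intro n N h1
    rw [show 2 * (m + 1) = 2 * m + 2 by ring, prod_two_step, pow_add]
    refine Nat.mul_le_mul (ih (n + 1) N (by omega)) ?_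
    subst h1
    nlinarith

theorem upper_odd (m : ℕ) : ∀ n N : ℕ, N = n + m →
    ∏ i ∈ Finset.range (2 * m + 1), (n + i) ≤ N ^ (2 * m + 1) := by
  induction m with
  | zero => intro n N h; simp [h]
  | succ m ih =>
    intro n N h1
    rw [show 2 * (m + 1) + 1 = (2 * m + 1) + 2 by ring, prod_two_step, pow_add]
    refine Nat.mul_le_mul (ih (n + 1) N (by omega)) ?_
    subst h1
    nlinarith

theorem stmt_18 (k : ℕ) (hk : 0 < k)
    (r : ℕ)
    (hr : r = if Even k then (k ^ 2 + 6 - 4 * k) / 4 else (k ^ 2 + 11 - 6 * k) / 4)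
    (n : ℕ) (hn : 0 < n) (hnr : r ≤ n) :
    (n + k / 2 - 1) ^ k ≤ ∏ i ∈ Finset.range k, (n + i) ∧
    ∏ i ∈ Finset.range k, (n + i) ≤ (n + k / 2) ^ k := by
  obtain ⟨m, rfl | rfl⟩ := Nat.even_or_odd' k
  · rw [if_pos (even_two_mul m), show (2 * m) ^ 2 = 4 * (m * m) by ring] at hr
    rw [show 2 * m / 2 = m by omega]
    exact ⟨lower_even m n _ (by omega) (by omega), upper_even m n _ rfl⟩
  · rw [if_neg (by simp), show (2 * m + 1) ^ 2 = 4 * (m * m) + 4 * m + 1 by ring] at hr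
    rw [show (2 * m + 1) / 2 = m by omega]
    refine ⟨?_, upper_odd m n _ rfl⟩
    rw [Finset.prod_range_succ, pow_succ]
    exact Nat.mul_le_mul (lower_even m n _ (by omega) (by omega)) (by omega)
end

section
/- Fix an integer k ∈ {2, 3, 4, 5, 7, 9} and let t = ⌊(k!·n)^{1/k}⌋. For every positive integer n, the n-th positive integer that is not a k-simplex number equals: n + t − ⌊k/2⌋ + 2 if n + t − ⌊k/2⌋ + 1 ≥ C(t + ⌈k/2⌉ + 1, k); n + t − ⌊k/2⌋ if n + t − ⌊k/2⌋ < C(t + ⌈k/2⌉, k); and n + t − ⌊k/2⌋ + 1 otherwise. -/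
theorem simplex_strictMono (K : ℕ) : StrictMono (fun m : ℕ => Nat.choose (m + K) (K + 1)) := by
  apply strictMono_nat_of_lt_succ
  intro m
  have h : (m + 1 + K).choose (K + 1) = (m + K).choose K + (m + K).choose (K + 1) := by
    rw [show m + 1 + K = (m + K) + 1 by ring, Nat.choose_succ_succ]
  have h2 : 0 < (m + K).choose K := Nat.choose_pos (by omega)
  show (m + K).choose (K + 1) < (m + 1 + K).choose (K + 1)
  omega

theorem nth_strictMono_compl (S : ℕ → ℕ) (hS : StrictMono S) (h0 : S 0 = 0) (n j : ℕ)
    (hn : 0 < n) (h1 : S j < n + j) (h2 : n + j < S (j + 1)) :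
    Nat.nth (fun x => 0 < x ∧ ¬∃ m : ℕ, 0 < m ∧ x = S m) (n - 1) = n + j := by
  classical
  set p : ℕ → Prop := fun x => 0 < x ∧ ¬∃ m : ℕ, 0 < m ∧ x = S m with hp
  have hpx : p (n + j) := by
    refine ⟨by omega, ?_⟩
    rintro ⟨m, _, hm⟩
    rw [hm] at h1 h2
    have a := hS.lt_iff_lt.1 h1
    have b := hS.lt_iff_lt.1 h2
    omega
  have hc : Nat.count p (n + j) = n - 1 := by
    rw [Nat.count_eq_card_filter_range]
    have e := Finset.card_filter_add_card_filter_not (s := Finset.range (n + j)) p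
    have f : (Finset.range (n + j)).filter (fun x => ¬ p x) = (Finset.range (j + 1)).image S := by
      ext x
      simp only [Finset.mem_filter, Finset.mem_range, Finset.mem_image, hp]
      constructor
      · rintro ⟨hx, hnp⟩
        have : ∃ m, S m = x := by
          by_cases hx0 : x = 0
          · exact ⟨0, by omega⟩
          · by_contra hcon
            apply hnp
            refine ⟨by omega, ?_⟩
            rintro ⟨m, _, hm⟩
            exact hcon ⟨m, hm.symm⟩
        obtain ⟨m, hm⟩ := this
        refine ⟨m, ?_, hm⟩
        apply hS.lt_iff_lt.1
        omega
      · rintro ⟨m, hm, rfl⟩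
        refine ⟨lt_of_le_of_lt (hS.monotone (by omega)) h1, ?_⟩
        rintro ⟨hpos, hne⟩
        apply hne
        refine ⟨m, ?_, rfl⟩
        rcases Nat.eq_zero_or_pos m with h | h
        · subst h; omega
        · exact h
    rw [f, Finset.card_image_of_injective _ hS.injective, Finset.card_range,
      Finset.card_range] at e
    have e3 := Nat.eq_sub_of_add_eq e
    have e2 : n + j - (j + 1) = n - 1 := by omega
    rw [e2] at e3
    convert e3
  rw [← hc]
  exact Nat.nth_count hpx

theorem floor_root_bounds (k N t : ℕ) (hk : 0 < k)
    (ht : t = ⌊(N : ℝ) ^ ((1 : ℝ) / k)⌋₊) : t ^ k ≤ N ∧ N < (t + 1) ^ k := by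
  have hnn : (0 : ℝ) ≤ (N : ℝ) ^ ((1 : ℝ) / k) := by positivity
  have hr : ((N : ℝ) ^ ((1 : ℝ) / k)) ^ k = N := by
    rw [one_div]
    exact Real.rpow_inv_natCast_pow (by positivity) (by omega)
  have h1 := Nat.floor_le hnn
  have h2 := Nat.lt_floor_add_one ((N : ℝ) ^ ((1 : ℝ) / k))
  rw [← ht] at h1 h2
  constructor
  · have := pow_le_pow_left₀ (by positivity) h1 k
    rw [hr] at this
    exact_mod_cast this
  · have := pow_lt_pow_left₀ h2 hnn (by omega : k ≠ 0)
    rw [hr] at this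
    exact_mod_cast this

/-- The combinatorial core: everything follows from `S a < n + a` and `n + a + 2 < S (a + 3)`. -/
theorem three_cases (K h n t a : ℕ) (hn : 0 < n) (hta : t = a + h) (hh : (K + 1) / 2 = h)
    (h1 : (a + K).choose (K + 1) ≤ n)
    (h2 : n + a + 2 < (a + 3 + K).choose (K + 1)) :
    ((n + t - (K + 1) / 2 + 1 ≥ Nat.choose (t + (K + 1 + 1) / 2 + 1) (K + 1) →
      Nat.nth (fun x => 0 < x ∧ ¬∃ m : ℕ, 0 < m ∧ x = Nat.choose (m + (K + 1) - 1) (K + 1))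
          (n - 1) = n + t - (K + 1) / 2 + 2) ∧
    (n + t - (K + 1) / 2 < Nat.choose (t + (K + 1 + 1) / 2) (K + 1) →
      Nat.nth (fun x => 0 < x ∧ ¬∃ m : ℕ, 0 < m ∧ x = Nat.choose (m + (K + 1) - 1) (K + 1))
          (n - 1) = n + t - (K + 1) / 2) ∧
    (n + t - (K + 1) / 2 + 1 < Nat.choose (t + (K + 1 + 1) / 2 + 1) (K + 1) ∧
        n + t - (K + 1) / 2 ≥ Nat.choose (t + (K + 1 + 1) / 2) (K + 1) →
      Nat.nth (fun x => 0 < x ∧ ¬∃ m : ℕ, 0 < m ∧ x = Nat.choose (m + (K + 1) - 1) (K + 1))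
          (n - 1) = n + t - (K + 1) / 2 + 1)) := by
  have e1 : n + t - (K + 1) / 2 = n + a := by omega
  have e2 : t + (K + 1 + 1) / 2 = a + 1 + K := by omega
  have e3 : a + 1 + K + 1 = a + 2 + K := by omega
  rw [e1, e2, e3]
  simp only [← Nat.add_assoc, Nat.add_sub_cancel]
  have hS := simplex_strictMono K
  have h0 : (0 + K).choose (K + 1) = 0 := Nat.choose_eq_zero_of_lt (by omega)
  have key := fun j => nth_strictMono_compl _ hS h0 n j hn
  refine ⟨fun hc => ?_, fun hc => ?_, fun hc => ?_⟩
  · exact key (a + 2) (by omega) (by rw [show a + 2 + 1 = a + 3 by rfl]; omega)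
  · refine key a ?_ (by omega)
    rcases Nat.eq_zero_or_pos a with ha | ha
    · subst ha; omega
    · omega
  · exact key (a + 1) (by omega) (by rw [show a + 1 + 1 = a + 2 by rfl]; omega)

theorem choose_bounds_2 (n t : ℕ) (hn : 0 < n) (h1 : t ^ 2 ≤ 2 * n)
    (h2 : 2 * n < (t + 1) ^ 2) : ∃ a, t = a + 1 ∧ (a + 1).choose 2 ≤ n ∧
      n + a + 2 < (a + 3 + 1).choose 2 := by
  have ht : 1 ≤ t := by
    by_contra hc
    have : (t + 1) ^ 2 ≤ 1 := Nat.pow_le_pow_left (n := t + 1) (m := 1) (by omega) 2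
    omega
  obtain ⟨a, rfl⟩ := Nat.exists_eq_add_of_le' ht
  have c2 : (a + 3) * (a + 4) = 2 * (a + 3 + 1).choose 2 := by
    have := Nat.ascFactorial_eq_factorial_mul_choose (a + 2) 2
    simp only [Nat.ascFactorial, Nat.factorial] at this
    rw [show a + 3 + 1 = a + 2 + 2 by ring]
    rw [show 2 * (a + 2 + 2).choose 2 = _ from this.symm]
    ring
  have c1 : a * (a + 1) = 2 * (a + 1).choose 2 := by
    rcases Nat.eq_zero_or_pos a with ha | ha
    · subst ha
      simp
    obtain ⟨b, rfl⟩ := Nat.exists_eq_add_of_le' ha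
    have := Nat.ascFactorial_eq_factorial_mul_choose b 2
    simp only [Nat.ascFactorial, Nat.factorial] at this
    rw [show b + 1 + 1 = b + 2 by ring]
    rw [show 2 * (b + 2).choose 2 = _ from this.symm]
    ring
  refine ⟨a, rfl, ?_, ?_⟩
  · have : a * (a + 1) ≤ (a + 1) ^ 2 := by
      have q : a * (a + 1) ≤ (a + 1) ^ 2 := by nlinarith
      have r := q
      calc _ = (a * (a + 1)) := by ring
        _ ≤ _ := r
        _ = _ := by ring
    omega
  · have : (a + 1 + 1) ^ 2 + 2 * (a + 2) ≤ (a + 3) * (a + 4) := by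
      exact le_of_le_of_eq (Nat.le_add_right _ (4 * a ^ 0 + 1 * a ^ 1)) (by ring)
    omega

theorem choose_bounds_3 (n t : ℕ) (hn : 0 < n) (h1 : t ^ 3 ≤ 6 * n)
    (h2 : 6 * n < (t + 1) ^ 3) : ∃ a, t = a + 1 ∧ (a + 2).choose 3 ≤ n ∧
      n + a + 2 < (a + 3 + 2).choose 3 := by
  have ht : 1 ≤ t := by
    by_contra hc
    have : (t + 1) ^ 3 ≤ 1 := Nat.pow_le_pow_left (n := t + 1) (m := 1) (by omega) 3
    omega
  obtain ⟨a, rfl⟩ := Nat.exists_eq_add_of_le' ht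
  have c2 : (a + 3) * (a + 4) * (a + 5) = 6 * (a + 3 + 2).choose 3 := by
    have := Nat.ascFactorial_eq_factorial_mul_choose (a + 2) 3
    simp only [Nat.ascFactorial, Nat.factorial] at this
    rw [show a + 3 + 2 = a + 2 + 3 by ring]
    rw [show 6 * (a + 2 + 3).choose 3 = _ from this.symm]
    ring
  have c1 : a * (a + 1) * (a + 2) = 6 * (a + 2).choose 3 := by
    rcases Nat.eq_zero_or_pos a with ha | ha
    · subst ha
      simp
    obtain ⟨b, rfl⟩ := Nat.exists_eq_add_of_le' ha
    have := Nat.ascFactorial_eq_factorial_mul_choose b 3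
    simp only [Nat.ascFactorial, Nat.factorial] at this
    rw [show b + 1 + 2 = b + 3 by ring]
    rw [show 6 * (b + 3).choose 3 = _ from this.symm]
    ring
  refine ⟨a, rfl, ?_, ?_⟩
  · have : a * (a + 1) * (a + 2) ≤ (a + 1) ^ 3 := by
      have p0 : a * (a + 2) ≤ (a + 1) ^ 2 := by nlinarith
      have r := Nat.mul_le_mul p0 (le_refl (a + 1))
      calc _ = (a * (a + 2)) * (a + 1) := by ring
        _ ≤ _ := r
        _ = _ := by ring
    omega
  · have : (a + 1 + 1) ^ 3 + 6 * (a + 2) ≤ (a + 3) * (a + 4) * (a + 5) := by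
      exact le_of_le_of_eq (Nat.le_add_right _ (40 * a ^ 0 + 29 * a ^ 1 + 6 * a ^ 2)) (by ring)
    omega

theorem choose_bounds_4 (n t : ℕ) (hn : 0 < n) (h1 : t ^ 4 ≤ 24 * n)
    (h2 : 24 * n < (t + 1) ^ 4) : ∃ a, t = a + 2 ∧ (a + 3).choose 4 ≤ n ∧
      n + a + 2 < (a + 3 + 3).choose 4 := by
  have ht : 2 ≤ t := by
    by_contra hc
    have : (t + 1) ^ 4 ≤ 16 := Nat.pow_le_pow_left (n := t + 1) (m := 2) (by omega) 4
    omega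
  obtain ⟨a, rfl⟩ := Nat.exists_eq_add_of_le' ht
  have c2 : (a + 3) * (a + 4) * (a + 5) * (a + 6) = 24 * (a + 3 + 3).choose 4 := by
    have := Nat.ascFactorial_eq_factorial_mul_choose (a + 2) 4
    simp only [Nat.ascFactorial, Nat.factorial] at this
    rw [show a + 3 + 3 = a + 2 + 4 by ring]
    rw [show 24 * (a + 2 + 4).choose 4 = _ from this.symm]
    ring
  have c1 : a * (a + 1) * (a + 2) * (a + 3) = 24 * (a + 3).choose 4 := by
    rcases Nat.eq_zero_or_pos a with ha | ha
    · subst ha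
      simp
    obtain ⟨b, rfl⟩ := Nat.exists_eq_add_of_le' ha
    have := Nat.ascFactorial_eq_factorial_mul_choose b 4
    simp only [Nat.ascFactorial, Nat.factorial] at this
    rw [show b + 1 + 3 = b + 4 by ring]
    rw [show 24 * (b + 4).choose 4 = _ from this.symm]
    ring
  refine ⟨a, rfl, ?_, ?_⟩
  · have : a * (a + 1) * (a + 2) * (a + 3) ≤ (a + 2) ^ 4 := by
      have p1 : (a + 1) * (a + 3) ≤ (a + 2) ^ 2 := by nlinarith
      have q : a * (a + 2) ≤ (a + 2) ^ 2 := by nlinarith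
      have r := (Nat.mul_le_mul p1 q)
      calc _ = ((a + 1) * (a + 3)) * (a * (a + 2)) := by ring
        _ ≤ _ := r
        _ = _ := by ring
    omega
  · have : (a + 2 + 1) ^ 4 + 24 * (a + 2) ≤ (a + 3) * (a + 4) * (a + 5) * (a + 6) := by
      exact le_of_le_of_eq (Nat.le_add_right _ (231 * a ^ 0 + 210 * a ^ 1 + 65 * a ^ 2 + 6 * a ^ 3)) (by ring)
    omega

theorem choose_bounds_5 (n t : ℕ) (hn : 0 < n) (h1 : t ^ 5 ≤ 120 * n)
    (h2 : 120 * n < (t + 1) ^ 5) : ∃ a, t = a + 2 ∧ (a + 4).choose 5 ≤ n ∧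
      n + a + 2 < (a + 3 + 4).choose 5 := by
  have ht : 2 ≤ t := by
    by_contra hc
    have : (t + 1) ^ 5 ≤ 32 := Nat.pow_le_pow_left (n := t + 1) (m := 2) (by omega) 5
    omega
  obtain ⟨a, rfl⟩ := Nat.exists_eq_add_of_le' ht
  have c2 : (a + 3) * (a + 4) * (a + 5) * (a + 6) * (a + 7) = 120 * (a + 3 + 4).choose 5 := by
    have := Nat.ascFactorial_eq_factorial_mul_choose (a + 2) 5
    simp only [Nat.ascFactorial, Nat.factorial] at this
    rw [show a + 3 + 4 = a + 2 + 5 by ring]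
    rw [show 120 * (a + 2 + 5).choose 5 = _ from this.symm]
    ring
  have c1 : a * (a + 1) * (a + 2) * (a + 3) * (a + 4) = 120 * (a + 4).choose 5 := by
    rcases Nat.eq_zero_or_pos a with ha | ha
    · subst ha
      simp
    obtain ⟨b, rfl⟩ := Nat.exists_eq_add_of_le' ha
    have := Nat.ascFactorial_eq_factorial_mul_choose b 5
    simp only [Nat.ascFactorial, Nat.factorial] at this
    rw [show b + 1 + 4 = b + 5 by ring]
    rw [show 120 * (b + 5).choose 5 = _ from this.symm]
    ring
  refine ⟨a, rfl, ?_, ?_⟩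
  · have : a * (a + 1) * (a + 2) * (a + 3) * (a + 4) ≤ (a + 2) ^ 5 := by
      have p1 : (a + 1) * (a + 3) ≤ (a + 2) ^ 2 := by nlinarith
      have p0 : a * (a + 4) ≤ (a + 2) ^ 2 := by nlinarith
      have r := Nat.mul_le_mul (Nat.mul_le_mul p1 p0) (le_refl (a + 2))
      calc _ = ((a + 1) * (a + 3)) * (a * (a + 4)) * (a + 2) := by ring
        _ ≤ _ := r
        _ = _ := by ring
    omega
  · have : (a + 2 + 1) ^ 5 + 120 * (a + 2) ≤ (a + 3) * (a + 4) * (a + 5) * (a + 6) * (a + 7) := by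
      exact le_of_le_of_eq (Nat.le_add_right _ (2037 * a ^ 0 + 2229 * a ^ 1 + 905 * a ^ 2 + 155 * a ^ 3 + 10 * a ^ 4)) (by ring)
    omega

theorem choose_bounds_7 (n t : ℕ) (hn : 0 < n) (h1 : t ^ 7 ≤ 5040 * n)
    (h2 : 5040 * n < (t + 1) ^ 7) : ∃ a, t = a + 3 ∧ (a + 6).choose 7 ≤ n ∧
      n + a + 2 < (a + 3 + 6).choose 7 := by
  have ht : 3 ≤ t := by
    by_contra hc
    have : (t + 1) ^ 7 ≤ 2187 := Nat.pow_le_pow_left (n := t + 1) (m := 3) (by omega) 7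
    omega
  obtain ⟨a, rfl⟩ := Nat.exists_eq_add_of_le' ht
  have c2 : (a + 3) * (a + 4) * (a + 5) * (a + 6) * (a + 7) * (a + 8) * (a + 9) = 5040 * (a + 3 + 6).choose 7 := by
    have := Nat.ascFactorial_eq_factorial_mul_choose (a + 2) 7
    simp only [Nat.ascFactorial, Nat.factorial] at this
    rw [show a + 3 + 6 = a + 2 + 7 by ring]
    rw [show 5040 * (a + 2 + 7).choose 7 = _ from this.symm]
    ring
  have c1 : a * (a + 1) * (a + 2) * (a + 3) * (a + 4) * (a + 5) * (a + 6) = 5040 * (a + 6).choose 7 := by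
    rcases Nat.eq_zero_or_pos a with ha | ha
    · subst ha
      simp
    obtain ⟨b, rfl⟩ := Nat.exists_eq_add_of_le' ha
    have := Nat.ascFactorial_eq_factorial_mul_choose b 7
    simp only [Nat.ascFactorial, Nat.factorial] at this
    rw [show b + 1 + 6 = b + 7 by ring]
    rw [show 5040 * (b + 7).choose 7 = _ from this.symm]
    ring
  refine ⟨a, rfl, ?_, ?_⟩
  · have : a * (a + 1) * (a + 2) * (a + 3) * (a + 4) * (a + 5) * (a + 6) ≤ (a + 3) ^ 7 := by
      have p2 : (a + 2) * (a + 4) ≤ (a + 3) ^ 2 := by nlinarith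
      have p1 : (a + 1) * (a + 5) ≤ (a + 3) ^ 2 := by nlinarith
      have p0 : a * (a + 6) ≤ (a + 3) ^ 2 := by nlinarith
      have r := Nat.mul_le_mul (Nat.mul_le_mul (Nat.mul_le_mul p2 p1) p0) (le_refl (a + 3))
      calc _ = ((a + 2) * (a + 4)) * ((a + 1) * (a + 5)) * (a * (a + 6)) * (a + 3) := by ring
        _ ≤ _ := r
        _ = _ := by ring
    omega
  · have : (a + 3 + 1) ^ 7 + 5040 * (a + 2) ≤ (a + 3) * (a + 4) * (a + 5) * (a + 6) * (a + 7) * (a + 8) * (a + 9) := by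
      exact le_of_le_of_eq (Nat.le_add_right _ (154976 * a ^ 0 + 207416 * a ^ 1 + 112434 * a ^ 2 + 31409 * a ^ 3 + 4900 * a ^ 4 + 406 * a ^ 5 + 14 * a ^ 6)) (by ring)
    omega

theorem choose_bounds_9 (n t : ℕ) (hn : 0 < n) (h1 : t ^ 9 ≤ 362880 * n)
    (h2 : 362880 * n < (t + 1) ^ 9) : ∃ a, t = a + 4 ∧ (a + 8).choose 9 ≤ n ∧
      n + a + 2 < (a + 3 + 8).choose 9 := by
  have ht : 4 ≤ t := by
    by_contra hc
    have : (t + 1) ^ 9 ≤ 262144 := Nat.pow_le_pow_left (n := t + 1) (m := 4) (by omega) 9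
    omega
  obtain ⟨a, rfl⟩ := Nat.exists_eq_add_of_le' ht
  have c2 : (a + 3) * (a + 4) * (a + 5) * (a + 6) * (a + 7) * (a + 8) * (a + 9) * (a + 10) * (a + 11) = 362880 * (a + 3 + 8).choose 9 := by
    have := Nat.ascFactorial_eq_factorial_mul_choose (a + 2) 9
    simp only [Nat.ascFactorial, Nat.factorial] at this
    rw [show a + 3 + 8 = a + 2 + 9 by ring]
    rw [show 362880 * (a + 2 + 9).choose 9 = _ from this.symm]
    ring
  have c1 : a * (a + 1) * (a + 2) * (a + 3) * (a + 4) * (a + 5) * (a + 6) * (a + 7) * (a + 8) = 362880 * (a + 8).choose 9 := by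
    rcases Nat.eq_zero_or_pos a with ha | ha
    · subst ha
      simp
    obtain ⟨b, rfl⟩ := Nat.exists_eq_add_of_le' ha
    have := Nat.ascFactorial_eq_factorial_mul_choose b 9
    simp only [Nat.ascFactorial, Nat.factorial] at this
    rw [show b + 1 + 8 = b + 9 by ring]
    rw [show 362880 * (b + 9).choose 9 = _ from this.symm]
    ring
  refine ⟨a, rfl, ?_, ?_⟩
  · have : a * (a + 1) * (a + 2) * (a + 3) * (a + 4) * (a + 5) * (a + 6) * (a + 7) * (a + 8) ≤ (a + 4) ^ 9 := by
      have p3 : (a + 3) * (a + 5) ≤ (a + 4) ^ 2 := by nlinarith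
      have p2 : (a + 2) * (a + 6) ≤ (a + 4) ^ 2 := by nlinarith
      have p1 : (a + 1) * (a + 7) ≤ (a + 4) ^ 2 := by nlinarith
      have p0 : a * (a + 8) ≤ (a + 4) ^ 2 := by nlinarith
      have r := Nat.mul_le_mul (Nat.mul_le_mul (Nat.mul_le_mul (Nat.mul_le_mul p3 p2) p1) p0) (le_refl (a + 4))
      calc _ = ((a + 3) * (a + 5)) * ((a + 2) * (a + 6)) * ((a + 1) * (a + 7)) * (a * (a + 8)) * (a + 4) := by ring
        _ ≤ _ := r
        _ = _ := by ring
    omega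
  · have : (a + 4 + 1) ^ 9 + 362880 * (a + 2) ≤ (a + 3) * (a + 4) * (a + 5) * (a + 6) * (a + 7) * (a + 8) * (a + 9) * (a + 10) * (a + 11) := by
      exact le_of_le_of_eq (Nat.le_add_right _ (17279515 * a ^ 0 + 26455815 * a ^ 1 + 17165808 * a ^ 2 + 6181916 * a ^ 3 + 1373337 * a ^ 4 + 193179 * a ^ 5 + 16842 * a ^ 6 + 834 * a ^ 7 + 18 * a ^ 8)) (by ring)
    omega

theorem stmt_19 (k : ℕ) (hk : k = 2 ∨ k = 3 ∨ k = 4 ∨ k = 5 ∨ k = 7 ∨ k = 9)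
    (n : ℕ) (hn : 0 < n)
    (t : ℕ) (ht : t = ⌊((Nat.factorial k * n : ℕ) : ℝ) ^ ((1 : ℝ) / k)⌋₊) :
    ((n + t - k / 2 + 1 ≥ Nat.choose (t + (k + 1) / 2 + 1) k →
      Nat.nth (fun x => 0 < x ∧ ¬∃ m : ℕ, 0 < m ∧ x = Nat.choose (m + k - 1) k)
          (n - 1) = n + t - k / 2 + 2) ∧
    (n + t - k / 2 < Nat.choose (t + (k + 1) / 2) k →
      Nat.nth (fun x => 0 < x ∧ ¬∃ m : ℕ, 0 < m ∧ x = Nat.choose (m + k - 1) k)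
          (n - 1) = n + t - k / 2) ∧
    (n + t - k / 2 + 1 < Nat.choose (t + (k + 1) / 2 + 1) k ∧
        n + t - k / 2 ≥ Nat.choose (t + (k + 1) / 2) k →
      Nat.nth (fun x => 0 < x ∧ ¬∃ m : ℕ, 0 < m ∧ x = Nat.choose (m + k - 1) k)
          (n - 1) = n + t - k / 2 + 1)) := by
  have hk0 : 0 < k := by omega
  obtain ⟨h1, h2⟩ := floor_root_bounds k _ t hk0 ht
  clear ht
  rcases hk with rfl | rfl | rfl | rfl | rfl | rfl
  · obtain ⟨a, e, b1, b2⟩ := choose_bounds_2 n t hn h1 h2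
    exact three_cases 1 1 n t a hn e rfl b1 b2
  · obtain ⟨a, e, b1, b2⟩ := choose_bounds_3 n t hn h1 h2
    exact three_cases 2 1 n t a hn e rfl b1 b2
  · obtain ⟨a, e, b1, b2⟩ := choose_bounds_4 n t hn h1 h2
    exact three_cases 3 2 n t a hn e rfl b1 b2
  · obtain ⟨a, e, b1, b2⟩ := choose_bounds_5 n t hn h1 h2
    exact three_cases 4 2 n t a hn e rfl b1 b2
  · obtain ⟨a, e, b1, b2⟩ := choose_bounds_7 n t hn h1 h2
    exact three_cases 6 3 n t a hn e rfl b1 b2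
  · obtain ⟨a, e, b1, b2⟩ := choose_bounds_9 n t hn h1 h2
    exact three_cases 8 4 n t a hn e rfl b1 b2
end
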